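/- For a multipartition μ of d and standard μ-tableaux S, T, the conjugation map satisfies w_{T'} = w^T, where T' is the conjugate tableau; consequently T ⊴ S in the dominance-induced Bruhat order if and only if w^T ≥ w^S in the Bruhat order on S_d. -/

import Mathlib

noncomputable section

open Equiv

/-! ## Symmetric group combinatorics: words, length, Bruhat order -/

/-- The adjacent transposition `(r, r+1)` (0-indexed) in `S_d`, or `1` if out of range. -/
def stp (d r : ℕ) : Equiv.Perm (Fin d) :=
  if h : r + 1 < d then Equiv.swap ⟨r, Nat.lt_of_succ_lt h⟩ ⟨r + 1, h⟩ else 1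

/-- The transposition `(x, y)` in `S_d`, or `1` if out of range. -/
def swapN (d x y : ℕ) : Equiv.Perm (Fin d) :=
  if hx : x < d then if hy : y < d then Equiv.swap ⟨x, hx⟩ ⟨y, hy⟩ else 1 else 1

/-- The product `s_{r_1} ⋯ s_{r_m}` of the word `l = [r_1, …, r_m]`. -/
def wordProd (d : ℕ) (l : List ℕ) : Equiv.Perm (Fin d) := (l.map (stp d)).prod

/-- A word in the Coxeter generators of `S_d` (0-indexed letters). -/
def IsWord (d : ℕ) (l : List ℕ) : Prop := ∀ r ∈ l, r + 1 < d

/-- Coxeter length in `S_d`. -/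
def len (d : ℕ) (w : Equiv.Perm (Fin d)) : ℕ :=
  sInf {n | ∃ lw, IsWord d lw ∧ lw.length = n ∧ wordProd d lw = w}

/-- `lw` is a reduced decomposition of `w`. -/
def IsReducedWord (d : ℕ) (w : Equiv.Perm (Fin d)) (lw : List ℕ) : Prop :=
  IsWord d lw ∧ wordProd d lw = w ∧ lw.length = len d w

/-- A single commutation (braid) move `… r t … ↦ … t r …` with `|r − t| > 1`. -/
def CommMove (l₁ l₂ : List ℕ) : Prop :=
  ∃ (a b : List ℕ) (r t : ℕ), (r + 2 ≤ t ∨ t + 2 ≤ r) ∧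
    l₁ = a ++ r :: t :: b ∧ l₂ = a ++ t :: r :: b

/-- `w` is fully commutative: any two reduced decompositions are connected by
commutation moves. -/
def FullyCommutative (d : ℕ) (w : Equiv.Perm (Fin d)) : Prop :=
  ∀ l₁ l₂, IsReducedWord d w l₁ → IsReducedWord d w l₂ →
    Relation.ReflTransGen CommMove l₁ l₂

/-- Bruhat order on `S_d` (via the subword property). -/
def Bruhat (d : ℕ) (u w : Equiv.Perm (Fin d)) : Prop :=
  ∃ lw, IsReducedWord d w lw ∧ ∃ lu, lu.Sublist lw ∧ wordProd d lu = u

/-- Strict Bruhat order. -/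
def BruhatLt (d : ℕ) (u w : Equiv.Perm (Fin d)) : Prop := Bruhat d u w ∧ u ≠ w

/-- The parabolic subgroup `S_s × S_{k−s}` of `S_k`:
generated by the `s_r` (1-indexed `r`) with `r ≠ s`. -/
def parab2 (k s : ℕ) : Subgroup (Equiv.Perm (Fin k)) :=
  Subgroup.closure {w | ∃ r, r + 1 < k ∧ r + 1 ≠ s ∧ w = stp k r}

/-- `w` has minimal length in its left coset `w H`. -/
def IsMinCosetRep (k : ℕ) (H : Subgroup (Equiv.Perm (Fin k))) (w : Equiv.Perm (Fin k)) : Prop :=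
  ∀ u ∈ H, len k w ≤ len k (w * u)

/-- Minimal length left coset representatives of `S_f × S_{k−f}` in `S_k`. -/
def Dfk (k f : ℕ) : Set (Equiv.Perm (Fin k)) := {u | IsMinCosetRep k (parab2 k f) u}

open Classical in
/-- Minimal length left coset representatives of `S_f × S_{k−f}` in `S_k`, as a finset. -/
def DfkFinset (k f : ℕ) : Finset (Equiv.Perm (Fin k)) :=
  Finset.univ.filter (fun u => u ∈ Dfk k f)

/-! ## Multipartitions and tableaux -/

/-- A node `(a, b, m)`: row `a`, column `b` (0-indexed), component `m`. -/
abbrev Node (l : ℕ) := ℕ × ℕ × Fin l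

/-- An `l`-multipartition of `d`, recorded by its row lengths. -/
structure MPar (l d : ℕ) where
  part : Fin l → ℕ → ℕ
  anti : ∀ m, ∀ ⦃a b : ℕ⦄, a ≤ b → part m b ≤ part m a
  supp : ∀ m a, d ≤ a → part m a = 0
  size : (∑ m : Fin l, ∑ a ∈ Finset.range d, part m a) = d

variable {l d : ℕ}

/-- Membership of a node in (the Young diagram of) `μ`. -/
def MPar.mem (μ : MPar l d) (x : Node l) : Prop := x.2.1 < μ.part x.2.2 x.1

/-- The nodes of `μ` as a subtype. -/
abbrev MPar.NodeIn (μ : MPar l d) := {x : Node l // μ.mem x}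

/-- A `μ`-tableau: a bijection from the nodes of `μ` to `{0, …, d−1}`. -/
abbrev MPar.Tab (μ : MPar l d) := μ.NodeIn ≃ Fin d

/-- Row-reading order on nodes. -/
def rowLt (x y : Node l) : Prop :=
  x.2.2 < y.2.2 ∨ (x.2.2 = y.2.2 ∧ (x.1 < y.1 ∨ (x.1 = y.1 ∧ x.2.1 < y.2.1)))

/-- Column-reading order on nodes (components in reversed order). -/
def colLt (x y : Node l) : Prop :=
  y.2.2 < x.2.2 ∨ (x.2.2 = y.2.2 ∧ (x.2.1 < y.2.1 ∨ (x.2.1 = y.2.1 ∧ x.1 < y.1)))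

/-- `T` is the row-reading tableau `T^μ`. -/
def MPar.IsRowReading (μ : MPar l d) (T : μ.Tab) : Prop :=
  ∀ x y : μ.NodeIn, rowLt x.1 y.1 → T x < T y

/-- `T` is the column-reading tableau `T_μ`. -/
def MPar.IsColReading (μ : MPar l d) (T : μ.Tab) : Prop :=
  ∀ x y : μ.NodeIn, colLt x.1 y.1 → T x < T y

/-- Row-strict tableau: entries increase along rows. -/
def MPar.RowStrict (μ : MPar l d) (T : μ.Tab) : Prop :=
  ∀ x y : μ.NodeIn, x.1.1 = y.1.1 → x.1.2.2 = y.1.2.2 → x.1.2.1 < y.1.2.1 → T x < T y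

/-- Column-strict tableau: entries increase down columns. -/
def MPar.ColStrict (μ : MPar l d) (T : μ.Tab) : Prop :=
  ∀ x y : μ.NodeIn, x.1.2.1 = y.1.2.1 → x.1.2.2 = y.1.2.2 → x.1.1 < y.1.1 → T x < T y

/-- Standard tableau. -/
def MPar.IsStandard (μ : MPar l d) (T : μ.Tab) : Prop := μ.RowStrict T ∧ μ.ColStrict T

/-- The permutation `w` with `w ∘ B = T`, e.g. `w^T = wTab T T^μ`, `w_T = wTab T T_μ`. -/
def MPar.wTab (μ : MPar l d) (T B : μ.Tab) : Equiv.Perm (Fin d) := B.symm.trans T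

/-- The node occupied by the entry `r` in `T`. -/
def MPar.nodeOf (μ : MPar l d) (T : μ.Tab) (r : Fin d) : Node l := (T.symm r).1

/-! ## Residues, degrees, codegrees, defect -/

/-- The residue `κ_m + b − a ∈ ℤ/eℤ` of a node `(a,b,m)`. -/
def res (e : ℕ) {l : ℕ} (κ : Fin l → ZMod e) (x : Node l) : ZMod e :=
  κ x.2.2 + (x.2.1 : ZMod e) - (x.1 : ZMod e)

/-- The residue sequence `i(T)` of a tableau. -/
def MPar.resSeq (e : ℕ) (κ : Fin l → ZMod e) (μ : MPar l d) (T : μ.Tab) : Fin d → ZMod e :=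
  fun r => res e κ (μ.nodeOf T r)

/-- A set of nodes is the diagram of a multipartition. -/
def IsDiagram {l : ℕ} (S : Set (Node l)) : Prop :=
  (∀ (a b : ℕ) (m : Fin l), ((a + 1, b, m) : Node l) ∈ S → ((a, b, m) : Node l) ∈ S) ∧
  (∀ (a b : ℕ) (m : Fin l), ((a, b + 1, m) : Node l) ∈ S → ((a, b, m) : Node l) ∈ S)

/-- `B` is an addable node for the diagram `S`. -/
def Addable {l : ℕ} (S : Set (Node l)) (B : Node l) : Prop := B ∉ S ∧ IsDiagram (insert B S)

/-- `A` is a removable node of the diagram `S`. -/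
def Removable {l : ℕ} (S : Set (Node l)) (A : Node l) : Prop := A ∈ S ∧ IsDiagram (S \ {A})

/-- `x` is strictly below `y`. -/
def NodeBelow {l : ℕ} (x y : Node l) : Prop := y.2.2 < x.2.2 ∨ (x.2.2 = y.2.2 ∧ y.1 < x.1)

/-- `d_A(S)`: addable minus removable `i`-nodes strictly below `A`. -/
def dLow (e : ℕ) {l : ℕ} (κ : Fin l → ZMod e) (S : Set (Node l)) (A : Node l) : ℤ :=
  ({B | Addable S B ∧ res e κ B = res e κ A ∧ NodeBelow B A} : Set (Node l)).ncard -
  ({B | Removable S B ∧ res e κ B = res e κ A ∧ NodeBelow B A} : Set (Node l)).ncard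

/-- `d^A(S)`: addable minus removable `i`-nodes strictly above `A`. -/
def dUp (e : ℕ) {l : ℕ} (κ : Fin l → ZMod e) (S : Set (Node l)) (A : Node l) : ℤ :=
  ({B | Addable S B ∧ res e κ B = res e κ A ∧ NodeBelow A B} : Set (Node l)).ncard -
  ({B | Removable S B ∧ res e κ B = res e κ A ∧ NodeBelow A B} : Set (Node l)).ncard

/-- The shape occupied by the entries `< r` of `T`. -/
def MPar.shapeLE (μ : MPar l d) (T : μ.Tab) (r : ℕ) : Set (Node l) :=
  {x | ∃ h : μ.mem x, ((T ⟨x, h⟩ : Fin d) : ℕ) < r}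

/-- The degree of a standard tableau. -/
def MPar.deg (e : ℕ) (κ : Fin l → ZMod e) (μ : MPar l d) (T : μ.Tab) : ℤ :=
  ∑ r : Fin d, dLow e κ (μ.shapeLE T ((r : ℕ) + 1)) (μ.nodeOf T r)

/-- The codegree of a standard tableau. -/
def MPar.codeg (e : ℕ) (κ : Fin l → ZMod e) (μ : MPar l d) (T : μ.Tab) : ℤ :=
  ∑ r : Fin d, dUp e κ (μ.shapeLE T (r : ℕ)) (μ.nodeOf T r)

/-- The Cartan matrix of type `A_∞` (`e = 0`) or `A_{e−1}^{(1)}` (`e > 0`). -/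
def cartanZ (e : ℕ) (i j : ZMod e) : ℤ :=
  if i = j then 2 else (if i = j + 1 then -1 else 0) + (if i + 1 = j then -1 else 0)

/-- The nodes of `μ` as a finset. -/
def MPar.nodesFinset (μ : MPar l d) : Finset (Node l) :=
  (Finset.range d ×ˢ Finset.range d ×ˢ (Finset.univ : Finset (Fin l))).filter
    (fun x => x.2.1 < μ.part x.2.2 x.1)

/-- The defect `(Λ, α) − (α, α)/2` of `α = cont(μ)` relative to `Λ = Σ_m Λ_{κ_m}`. -/
def defectOf (e : ℕ) {l d : ℕ} (κ : Fin l → ZMod e) (μ : MPar l d) : ℤ :=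
  (∑ m : Fin l, ((μ.nodesFinset.filter (fun x => res e κ x = κ m)).card : ℤ)) -
  (∑ x ∈ μ.nodesFinset, ∑ y ∈ μ.nodesFinset, cartanZ e (res e κ x) (res e κ y)) / 2

/-! ## Conjugation -/

/-- Conjugation of nodes: `(a, b, m) ↦ (b, a, l−1−m)`. -/
def nodeConj {l : ℕ} (x : Node l) : Node l := (x.2.1, x.1, x.2.2.rev)

lemma nodeConj_invol {l : ℕ} : Function.Involutive (nodeConj (l := l)) := by
  intro x; simp [nodeConj]

/-- Conjugation of nodes as a bijection. -/
def nodeConjEquiv (l : ℕ) : Equiv.Perm (Node l) :=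
  Function.Involutive.toPerm nodeConj nodeConj_invol

/-- `ν` is the conjugate multipartition `μ'` of `μ`. -/
def IsConjugate (μ ν : MPar l d) : Prop := ∀ x : Node l, μ.mem x ↔ ν.mem (nodeConj x)

/-- The conjugate tableau `T'` of `T`. -/
def conjTab {μ ν : MPar l d} (h : IsConjugate μ ν) (T : μ.Tab) : ν.Tab :=
  (Equiv.subtypeEquiv (nodeConjEquiv l) (fun x => h x)).symm.trans T

/-! ## Garnir nodes, belts, tableaux, and bricks -/

variable (e : ℕ)

/-- A row Garnir node: `(a+1, b, m)` is also a node. -/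
def MPar.IsGarnirNode (μ : MPar l d) (A : Node l) : Prop :=
  μ.mem A ∧ μ.mem (A.1 + 1, A.2.1, A.2.2)

/-- The row `A`-Garnir belt. -/
def MPar.beltR (μ : MPar l d) (A : Node l) : Set (Node l) :=
  {x | x.2.2 = A.2.2 ∧
    ((x.1 = A.1 ∧ A.2.1 ≤ x.2.1 ∧ μ.mem x) ∨ (x.1 = A.1 + 1 ∧ x.2.1 ≤ A.2.1))}

/-- Reading order on the row Garnir belt: bottom-left to top-right. -/
def beltRLt (A x y : Node l) : Prop :=
  (x.1 = A.1 + 1 ∧ y.1 = A.1) ∨ (x.1 = y.1 ∧ x.2.1 < y.2.1)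

/-- `G` is the row `A`-Garnir tableau `G^A`: it agrees with the row-reading tableau `Tr`
outside the belt and is increasing along the belt reading order. -/
def MPar.IsGarnirTab (μ : MPar l d) (Tr : μ.Tab) (A : Node l) (G : μ.Tab) : Prop :=
  (∀ x : μ.NodeIn, x.1 ∉ μ.beltR A → G x = Tr x) ∧
  (∀ x y : μ.NodeIn, x.1 ∈ μ.beltR A → y.1 ∈ μ.beltR A → beltRLt A x.1 y.1 → G x < G y)

/-- A column Garnir node: `(a, b+1, m)` is also a node. -/
def MPar.IsColGarnirNode (μ : MPar l d) (A : Node l) : Prop :=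
  μ.mem A ∧ μ.mem (A.1, A.2.1 + 1, A.2.2)

/-- The column `A`-Garnir belt. -/
def MPar.beltC (μ : MPar l d) (A : Node l) : Set (Node l) :=
  {x | x.2.2 = A.2.2 ∧
    ((x.2.1 = A.2.1 ∧ A.1 ≤ x.1 ∧ μ.mem x) ∨ (x.2.1 = A.2.1 + 1 ∧ x.1 ≤ A.1))}

/-- Reading order on the column Garnir belt: top-right to bottom-left. -/
def beltCLt (A x y : Node l) : Prop :=
  (x.2.1 = A.2.1 + 1 ∧ y.2.1 = A.2.1) ∨ (x.2.1 = y.2.1 ∧ x.1 < y.1)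

/-- `G` is the column `A`-Garnir tableau `G_A`. -/
def MPar.IsColGarnirTab (μ : MPar l d) (Tc : μ.Tab) (A : Node l) (G : μ.Tab) : Prop :=
  (∀ x : μ.NodeIn, x.1 ∉ μ.beltC A → G x = Tc x) ∧
  (∀ x y : μ.NodeIn, x.1 ∈ μ.beltC A → y.1 ∈ μ.beltC A → beltCLt A x.1 y.1 → G x < G y)

/-- A row `A`-brick with leftmost node `(p.1, p.2, m)`: `e` successive nodes of the belt in
one row, the leftmost of residue `res A`. -/
def MPar.IsBrickR (κ : Fin l → ZMod e) (μ : MPar l d) (A : Node l) (p : ℕ × ℕ) : Prop :=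
  0 < e ∧ (∀ t < e, ((p.1, p.2 + t, A.2.2) : Node l) ∈ μ.beltR A) ∧
    res e κ (p.1, p.2, A.2.2) = res e κ A

/-- `k^A`: the number of bricks in the row Garnir belt. -/
def MPar.kAR (κ : Fin l → ZMod e) (μ : MPar l d) (A : Node l) : ℕ :=
  {p : ℕ × ℕ | μ.IsBrickR e κ A p}.ncard

/-- `f^A`: the number of bricks in the upper row `a` of the row Garnir belt. -/
def MPar.fAR (κ : Fin l → ZMod e) (μ : MPar l d) (A : Node l) : ℕ :=
  {p : ℕ × ℕ | μ.IsBrickR e κ A p ∧ p.1 = A.1}.ncard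

/-- The node `x` lies in some row brick. -/
def MPar.inBrickR (κ : Fin l → ZMod e) (μ : MPar l d) (A : Node l) (x : Node l) : Prop :=
  ∃ p : ℕ × ℕ, μ.IsBrickR e κ A p ∧ x.1 = p.1 ∧ x.2.2 = A.2.2 ∧ p.2 ≤ x.2.1 ∧ x.2.1 < p.2 + e

/-- `n^A` (0-indexed): the smallest entry of `G` lying in a brick. -/
def MPar.nAR (κ : Fin l → ZMod e) (μ : MPar l d) (A : Node l) (G : μ.Tab) : ℕ :=
  sInf {q | ∃ x : μ.NodeIn, μ.inBrickR e κ A x.1 ∧ ((G x : Fin d) : ℕ) = q}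

/-- The permutation swapping the `rb`-th and `(rb+1)`-st `e`-blocks of entries starting
at the entry `nn` (everything 0-indexed). -/
def wBrickP (d nn e rb : ℕ) : Equiv.Perm (Fin d) :=
  ((List.range e).map (fun j => swapN d (nn + rb * e + j) (nn + rb * e + e + j))).prod

/-- The row brick permutation group `S^A ≤ S_d`. -/
def MPar.brickGroupR (κ : Fin l → ZMod e) (μ : MPar l d) (A : Node l) (G : μ.Tab) :
    Subgroup (Equiv.Perm (Fin d)) :=
  Subgroup.closure {w | ∃ rb, rb + 1 < μ.kAR e κ A ∧ w = wBrickP d (μ.nAR e κ A G) e rb}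

/-- `Gar^A`: row-strict tableaux obtained from `G = G^A` by brick permutations. -/
def MPar.GarSetR (κ : Fin l → ZMod e) (μ : MPar l d) (A : Node l) (G : μ.Tab) :
    Set (μ.Tab) :=
  {T | μ.RowStrict T ∧ ∃ w ∈ μ.brickGroupR e κ A G, ∀ x, T x = w (G x)}

/-- `TA` is the Bruhat-maximal tableau `T^A` of `Gar^A` (`⊴` via `w_T`, base `Tc = T_μ`). -/
def MPar.IsMaxGarR (κ : Fin l → ZMod e) (μ : MPar l d) (Tc : μ.Tab) (A : Node l)
    (G TA : μ.Tab) : Prop :=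
  TA ∈ μ.GarSetR e κ A G ∧ ∀ T ∈ μ.GarSetR e κ A G, Bruhat d (μ.wTab T Tc) (μ.wTab TA Tc)

/-- A column `A`-brick with top node `(p.1, p.2, m)`. -/
def MPar.IsBrickC (κ : Fin l → ZMod e) (μ : MPar l d) (A : Node l) (p : ℕ × ℕ) : Prop :=
  0 < e ∧ (∀ t < e, ((p.1 + t, p.2, A.2.2) : Node l) ∈ μ.beltC A) ∧
    res e κ (p.1, p.2, A.2.2) = res e κ A

/-- `k_A`: the number of bricks in the column Garnir belt. -/
def MPar.kAC (κ : Fin l → ZMod e) (μ : MPar l d) (A : Node l) : ℕ :=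
  {p : ℕ × ℕ | μ.IsBrickC e κ A p}.ncard

/-- `f_A`: the number of bricks in column `b` of the column Garnir belt. -/
def MPar.fAC (κ : Fin l → ZMod e) (μ : MPar l d) (A : Node l) : ℕ :=
  {p : ℕ × ℕ | μ.IsBrickC e κ A p ∧ p.2 = A.2.1}.ncard

/-- The node `x` lies in some column brick. -/
def MPar.inBrickC (κ : Fin l → ZMod e) (μ : MPar l d) (A : Node l) (x : Node l) : Prop :=
  ∃ p : ℕ × ℕ, μ.IsBrickC e κ A p ∧ x.2.1 = p.2 ∧ x.2.2 = A.2.2 ∧ p.1 ≤ x.1 ∧ x.1 < p.1 + e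

/-- `n_A` (0-indexed): the smallest entry of `G` lying in a column brick. -/
def MPar.nAC (κ : Fin l → ZMod e) (μ : MPar l d) (A : Node l) (G : μ.Tab) : ℕ :=
  sInf {q | ∃ x : μ.NodeIn, μ.inBrickC e κ A x.1 ∧ ((G x : Fin d) : ℕ) = q}

/-- The column brick permutation group `S_A ≤ S_d`. -/
def MPar.brickGroupC (κ : Fin l → ZMod e) (μ : MPar l d) (A : Node l) (G : μ.Tab) :
    Subgroup (Equiv.Perm (Fin d)) :=
  Subgroup.closure {w | ∃ rb, rb + 1 < μ.kAC e κ A ∧ w = wBrickP d (μ.nAC e κ A G) e rb}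

/-- `Gar_A`: column-strict tableaux obtained from `G = G_A` by brick permutations. -/
def MPar.GarSetC (κ : Fin l → ZMod e) (μ : MPar l d) (A : Node l) (G : μ.Tab) :
    Set (μ.Tab) :=
  {T | μ.ColStrict T ∧ ∃ w ∈ μ.brickGroupC e κ A G, ∀ x, T x = w (G x)}

/-- `TA` is the Bruhat-minimal tableau `T_A` of `Gar_A`. -/
def MPar.IsMinGarC (κ : Fin l → ZMod e) (μ : MPar l d) (Tc : μ.Tab) (A : Node l)
    (G TA : μ.Tab) : Prop :=
  TA ∈ μ.GarSetC e κ A G ∧ ∀ T ∈ μ.GarSetC e κ A G, Bruhat d (μ.wTab TA Tc) (μ.wTab T Tc)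

/-! ## The KLR algebra `R_α` by generators and relations -/

/-- Generators of the KLR algebra: idempotents `e(i)`, polynomial generators `y_r`,
and intertwiners `ψ_r`. -/
inductive KLRGen (e d : ℕ) : Type
  | E : (Fin d → ZMod e) → KLRGen e d
  | Y : Fin d → KLRGen e d
  | P : Fin (d - 1) → KLRGen e d

/-- The position `r` as an element of `Fin d`. -/
def finL {d : ℕ} (r : Fin (d - 1)) : Fin d := ⟨r.1, by have := r.2; omega⟩

/-- The position `r + 1` as an element of `Fin d`. -/
def finR {d : ℕ} (r : Fin (d - 1)) : Fin d := ⟨r.1 + 1, by have := r.2; omega⟩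

/-- The place-permutation action of `s_r` on tuples. -/
def swapTup {e d : ℕ} (r : Fin (d - 1)) (i : Fin d → ZMod e) : Fin d → ZMod e :=
  i ∘ (Equiv.swap (finL r) (finR r))

/-- `I^α`: the set of tuples with the same content as the reference tuple `i0`. -/
def tupleOrbit {e d : ℕ} (i0 : Fin d → ZMod e) : Finset (Fin d → ZMod e) :=
  Finset.image (fun w : Equiv.Perm (Fin d) => i0 ∘ w) Finset.univ

section KLRDef

variable (O : Type) [CommRing O] (e d : ℕ)

/-- Image of the generator `e(i)` in the free algebra. -/
def fE (i : Fin d → ZMod e) : FreeAlgebra O (KLRGen e d) := FreeAlgebra.ι O (KLRGen.E i)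

/-- Image of the generator `y_r` in the free algebra. -/
def fY (r : Fin d) : FreeAlgebra O (KLRGen e d) := FreeAlgebra.ι O (KLRGen.Y r)

/-- Image of the generator `ψ_r` in the free algebra. -/
def fP (r : Fin (d - 1)) : FreeAlgebra O (KLRGen e d) := FreeAlgebra.ι O (KLRGen.P r)

/-- Right hand side of the quadratic relation for `ψ_r² e(i)`. -/
def quadElt (i : Fin d → ZMod e) (r : Fin (d - 1)) : FreeAlgebra O (KLRGen e d) :=
  let a := i (finL r); let b := i (finR r)
  if a = b then 0
  else if b = a - 1 ∧ b = a + 1 then (fY O e d (finR r) - fY O e d (finL r)) *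
    (fY O e d (finL r) - fY O e d (finR r)) * fE O e d i
  else if b = a - 1 then (fY O e d (finR r) - fY O e d (finL r)) * fE O e d i
  else if b = a + 1 then (fY O e d (finL r) - fY O e d (finR r)) * fE O e d i
  else fE O e d i

/-- Correction term in the braid relation, at positions `rl < rm < rr`. -/
def braidCorr (i : Fin d → ZMod e) (rl rm rr : Fin d) : FreeAlgebra O (KLRGen e d) :=
  let a := i rl; let b := i rm; let c := i rr
  if c = a ∧ b = a - 1 ∧ b = a + 1 then
    (fY O e d rl + fY O e d rr - 2 * fY O e d rm) * fE O e d i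
  else if c = a ∧ b = a - 1 then fE O e d i
  else if c = a ∧ b = a + 1 then -(fE O e d i)
  else 0

/-- The defining relations of the KLR algebra `R_α`, where `α` is the content of the
reference tuple `i0`. -/
inductive KLRRel (i0 : Fin d → ZMod e) :
    FreeAlgebra O (KLRGen e d) → FreeAlgebra O (KLRGen e d) → Prop
  | idem (i j : Fin d → ZMod e) :
      KLRRel i0 (fE O e d i * fE O e d j) (if i = j then fE O e d i else 0)
  | unit : KLRRel i0 (∑ i ∈ tupleOrbit i0, fE O e d i) 1
  | wrongContent (i : Fin d → ZMod e) (h : i ∉ tupleOrbit i0) : KLRRel i0 (fE O e d i) 0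
  | yE (r : Fin d) (i : Fin d → ZMod e) :
      KLRRel i0 (fY O e d r * fE O e d i) (fE O e d i * fY O e d r)
  | pE (r : Fin (d - 1)) (i : Fin d → ZMod e) :
      KLRRel i0 (fP O e d r * fE O e d i) (fE O e d (swapTup r i) * fP O e d r)
  | yy (r s : Fin d) : KLRRel i0 (fY O e d r * fY O e d s) (fY O e d s * fY O e d r)
  | py (r : Fin (d - 1)) (s : Fin d) (h1 : s ≠ finL r) (h2 : s ≠ finR r) :
      KLRRel i0 (fP O e d r * fY O e d s) (fY O e d s * fP O e d r)
  | pp (r t : Fin (d - 1)) (h : r.1 + 2 ≤ t.1 ∨ t.1 + 2 ≤ r.1) :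
      KLRRel i0 (fP O e d r * fP O e d t) (fP O e d t * fP O e d r)
  | pyE (r : Fin (d - 1)) (i : Fin d → ZMod e) :
      KLRRel i0 (fP O e d r * fY O e d (finR r) * fE O e d i)
        ((fY O e d (finL r) * fP O e d r +
          if i (finL r) = i (finR r) then 1 else 0) * fE O e d i)
  | ypE (r : Fin (d - 1)) (i : Fin d → ZMod e) :
      KLRRel i0 (fY O e d (finR r) * fP O e d r * fE O e d i)
        ((fP O e d r * fY O e d (finL r) +
          if i (finL r) = i (finR r) then 1 else 0) * fE O e d i)
  | quad (r : Fin (d - 1)) (i : Fin d → ZMod e) :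
      KLRRel i0 (fP O e d r * fP O e d r * fE O e d i) (quadElt O e d i r)
  | braid (r : Fin (d - 1)) (h : r.1 + 1 < d - 1) (i : Fin d → ZMod e) :
      KLRRel i0 (fP O e d r * fP O e d ⟨r.1 + 1, h⟩ * fP O e d r * fE O e d i)
        (fP O e d ⟨r.1 + 1, h⟩ * fP O e d r * fP O e d ⟨r.1 + 1, h⟩ * fE O e d i +
          braidCorr O e d i (finL r) (finR r) ⟨r.1 + 2, by omega⟩)

/-- The KLR algebra `R_α` over `O`, where `α` is the content of the tuple `i0`. -/
abbrev KLR (i0 : Fin d → ZMod e) : Type := RingQuot (KLRRel O e d i0)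

end KLRDef

section KLRElts

variable (O : Type) [CommRing O] {e d : ℕ} (i0 : Fin d → ZMod e)

/-- The idempotent generator `e(i)` of `R_α`. -/
def eK (i : Fin d → ZMod e) : KLR O e d i0 :=
  RingQuot.mkAlgHom O (KLRRel O e d i0) (fE O e d i)

/-- The generator `y_r` of `R_α`. -/
def yK (r : Fin d) : KLR O e d i0 :=
  RingQuot.mkAlgHom O (KLRRel O e d i0) (fY O e d r)

/-- The generator `ψ_r` of `R_α`. -/
def pK (r : Fin (d - 1)) : KLR O e d i0 :=
  RingQuot.mkAlgHom O (KLRRel O e d i0) (fP O e d r)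

/-- `y_s` for a natural number index (0-indexed), or `0` out of range. -/
def yN (s : ℕ) : KLR O e d i0 := if h : s < d then yK O i0 ⟨s, h⟩ else 0

/-- `ψ_t` for a natural number index (0-indexed), or `0` out of range. -/
def pN (t : ℕ) : KLR O e d i0 := if h : t < d - 1 then pK O i0 ⟨t, h⟩ else 0

/-- `ψ_{r_1} ⋯ ψ_{r_m}` for a word `[r_1, …, r_m]`. -/
def psiWord (lw : List ℕ) : KLR O e d i0 := (lw.map (pN O i0)).prod

/-- `ψ_w` relative to a choice `rd` of preferred reduced decompositions. -/
def psiPerm (rd : Equiv.Perm (Fin d) → List ℕ) (w : Equiv.Perm (Fin d)) : KLR O e d i0 :=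
  psiWord O i0 (rd w)

end KLRElts

/-! ## The grading on the KLR algebra -/

/-- One step in computing the degree of a word in the generators, scanning right to left:
the state is (accumulated degree, current tuple). -/
def gstep {e d : ℕ} (g : KLRGen e d) (p : ℤ × (Fin d → ZMod e)) : ℤ × (Fin d → ZMod e) :=
  match g with
  | .E i => (p.1, i)
  | .Y _ => (p.1 + 2, p.2)
  | .P r => (p.1 - cartanZ e (p.2 (finL r)) (p.2 (finR r)), swapTup r p.2)

/-- The degree of the word `lg` followed by the idempotent `e(j)`. -/
def wordDeg {e d : ℕ} (lg : List (KLRGen e d)) (j : Fin d → ZMod e) : ℤ :=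
  (lg.foldr gstep (0, j)).1

/-- The degree-`n` homogeneous component of `R_α`, as an `O`-submodule. -/
def algGrade (O : Type) [CommRing O] {e d : ℕ} (i0 : Fin d → ZMod e) (n : ℤ) :
    Submodule O (KLR O e d i0) :=
  Submodule.span O {x | ∃ (lg : List (KLRGen e d)) (j : Fin d → ZMod e),
    wordDeg lg j = n ∧
    x = RingQuot.mkAlgHom O (KLRRel O e d i0) ((lg.map (FreeAlgebra.ι O)).prod * fE O e d j)}

/-! ## Cyclic modules presented by a set of left-ideal generators -/

section Modules

variable (O : Type) [CommRing O] {e d : ℕ} (i0 : Fin d → ZMod e)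

/-- The cyclic `R_α`-module `R_α / (left ideal generated by S)`. -/
abbrev QuotBy (S : Set (KLR O e d i0)) : Type :=
  KLR O e d i0 ⧸ Submodule.span (KLR O e d i0) S

/-- The canonical cyclic generator (image of `1`) of `QuotBy S`. -/
def genQ (S : Set (KLR O e d i0)) : QuotBy O i0 S :=
  Submodule.Quotient.mk 1

/-- Degree-`n` part of the cyclic graded module `QuotBy S` whose generator
is placed in degree `base`. -/
def gradeQ (S : Set (KLR O e d i0)) (base n : ℤ) : Submodule O (QuotBy O i0 S) :=
  Submodule.span O {v | ∃ x ∈ algGrade O i0 (n - base), v = x • genQ O i0 S}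

/-- Generators of the annihilator ideal of a "permutation module" with reference
idempotent `e(iref)` and parabolic crossings `psis`: this encodes the relations
`e(j) m = δ_{j,iref} m`, `y_r m = 0`, and `ψ_t m = 0` for `s_t` in the parabolic. -/
def permGens (iref : Fin d → ZMod e) (psis : Set ℕ) : Set (KLR O e d i0) :=
  {x | ∃ j : Fin d → ZMod e, x = eK O i0 j - (if j = iref then 1 else 0)} ∪
  {x | ∃ r : Fin d, x = yK O i0 r} ∪
  {x | ∃ t ∈ psis, x = pN O i0 t}

end Modules

/-! ## Row/column permutation modules and Garnir elements -/

/-- Crossings `t` such that the entries `t, t+1` of `Tr` lie in the same row of the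
same component; for `Tr = T^μ` these generate the row parabolic. -/
def MPar.rowPsiSet {l d : ℕ} (μ : MPar l d) (Tr : μ.Tab) : Set ℕ :=
  {t | ∃ h : t + 1 < d, (μ.nodeOf Tr ⟨t, Nat.lt_of_succ_lt h⟩).1 = (μ.nodeOf Tr ⟨t + 1, h⟩).1 ∧
      (μ.nodeOf Tr ⟨t, Nat.lt_of_succ_lt h⟩).2.2 = (μ.nodeOf Tr ⟨t + 1, h⟩).2.2}

/-- Crossings `t` such that the entries `t, t+1` of `Tc` lie in the same column of the
same component; for `Tc = T_μ` these generate the column parabolic. -/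
def MPar.colPsiSet {l d : ℕ} (μ : MPar l d) (Tc : μ.Tab) : Set ℕ :=
  {t | ∃ h : t + 1 < d,
      (μ.nodeOf Tc ⟨t, Nat.lt_of_succ_lt h⟩).2.1 = (μ.nodeOf Tc ⟨t + 1, h⟩).2.1 ∧
      (μ.nodeOf Tc ⟨t, Nat.lt_of_succ_lt h⟩).2.2 = (μ.nodeOf Tc ⟨t + 1, h⟩).2.2}

section Garnir

variable (O : Type) [CommRing O] {e l d : ℕ} (κ : Fin l → ZMod e) {μ : MPar l d}
  (i0 : Fin d → ZMod e) (rdAll : ∀ q : ℕ, Equiv.Perm (Fin q) → List ℕ)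

/-- The row brick intertwiner `σ^A_r = ψ_{w^A_r} e(i^A)` (0-indexed `rb`). -/
def sigmaR (A : Node l) (G : μ.Tab) (rb : ℕ) : KLR O e d i0 :=
  psiWord O i0 (rdAll d (wBrickP d (μ.nAR e κ A G) e rb)) * eK O i0 (μ.resSeq e κ G)

/-- The row brick intertwiner `τ^A_r = (σ^A_r + 1) e(i^A)`. -/
def tauR (A : Node l) (G : μ.Tab) (rb : ℕ) : KLR O e d i0 :=
  sigmaR O κ i0 rdAll A G rb + eK O i0 (μ.resSeq e κ G)

/-- `τ^A_u` for `u ∈ S_k`, via the preferred reduced decomposition of `u`. -/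
def tauRU (A : Node l) (G : μ.Tab) (kk : ℕ) (u : Equiv.Perm (Fin kk)) : KLR O e d i0 :=
  ((rdAll kk u).map (fun rb => tauR O κ i0 rdAll A G rb)).prod

/-- The homogeneous row Garnir element `g^A = Σ_{u ∈ D^A} τ^A_u ψ^{T^A}`. -/
def garnirR (Tr : μ.Tab) (A : Node l) (G TA : μ.Tab) : KLR O e d i0 :=
  ∑ u ∈ DfkFinset (μ.kAR e κ A) (μ.fAR e κ A),
    tauRU O κ i0 rdAll A G (μ.kAR e κ A) u * psiWord O i0 (rdAll d (μ.wTab TA Tr))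

/-- The column brick intertwiner `σ^r_A = (−1)^e ψ_{w^r_A} e(i_A)`. -/
def sigmaC (A : Node l) (G : μ.Tab) (rb : ℕ) : KLR O e d i0 :=
  ((-1 : KLR O e d i0) ^ e) *
    psiWord O i0 (rdAll d (wBrickP d (μ.nAC e κ A G) e rb)) * eK O i0 (μ.resSeq e κ G)

/-- The column brick intertwiner `τ^r_A = (σ^r_A + 1) e(i_A)`. -/
def tauC (A : Node l) (G : μ.Tab) (rb : ℕ) : KLR O e d i0 :=
  sigmaC O κ i0 rdAll A G rb + eK O i0 (μ.resSeq e κ G)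

/-- `τ^u_A` for `u ∈ S_k`. -/
def tauCU (A : Node l) (G : μ.Tab) (kk : ℕ) (u : Equiv.Perm (Fin kk)) : KLR O e d i0 :=
  ((rdAll kk u).map (fun rb => tauC O κ i0 rdAll A G rb)).prod

/-- The homogeneous column Garnir element `g_A = Σ_{u ∈ D_A} τ^u_A ψ_{T_A}`. -/
def garnirC (Tc : μ.Tab) (A : Node l) (G TA : μ.Tab) : KLR O e d i0 :=
  ∑ u ∈ DfkFinset (μ.kAC e κ A) (μ.fAC e κ A),
    tauCU O κ i0 rdAll A G (μ.kAC e κ A) u * psiWord O i0 (rdAll d (μ.wTab TA Tc))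

/-- Generators of the defining left ideal of the universal graded row Specht
module `S^μ` (relations (i)–(iv) of the universal Specht presentation). -/
def spechtRowGens (Tr Tc : μ.Tab) : Set (KLR O e d i0) :=
  permGens O i0 (μ.resSeq e κ Tr) (μ.rowPsiSet Tr) ∪
  {x | ∃ (A : Node l) (G TA : μ.Tab), μ.IsGarnirNode A ∧ μ.IsGarnirTab Tr A G ∧
      μ.IsMaxGarR e κ Tc A G TA ∧ x = garnirR O κ i0 rdAll Tr A G TA}

/-- Generators of the defining left ideal of the universal graded column Specht
module `S_μ`. -/
def spechtColGens (Tc : μ.Tab) : Set (KLR O e d i0) :=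
  permGens O i0 (μ.resSeq e κ Tc) (μ.colPsiSet Tc) ∪
  {x | ∃ (A : Node l) (G TA : μ.Tab), μ.IsColGarnirNode A ∧ μ.IsColGarnirTab Tc A G ∧
      μ.IsMinGarC e κ Tc A G TA ∧ x = garnirC O κ i0 rdAll Tc A G TA}

end Garnir

/-! ## Block intertwiners for `R_{kδ}` -/

/-- The tuple `s(i, ke) = (i, i+1, …, i+ke−1)`, of content `kδ`. -/
def segTup (e k : ℕ) (i : ZMod e) : Fin (k * e) → ZMod e := fun t => i + ((t : ℕ) : ZMod e)

/-- The multiples `e·(λ_1 + ⋯ + λ_j)` of partial sums of a composition, scaled by `e`. -/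
def cutSet (e : ℕ) {n : ℕ} (lam : Fin n → ℕ) : Set ℕ :=
  {t | ∃ j : Fin n, t = e * ∑ j' ∈ Finset.univ.filter (fun j' => j' ≤ j), lam j'}

/-- Crossings `t` (0-indexed) with `s_t` in the parabolic `S_{eλ_1} × ⋯ × S_{eλ_n}`. -/
def blockPsiSet (e k : ℕ) {n : ℕ} (lam : Fin n → ℕ) : Set ℕ :=
  {t | t + 1 < k * e ∧ (t + 1) ∉ cutSet e lam}

section Block

variable (O : Type) [CommRing O] (e k : ℕ) (i : ZMod e) {n : ℕ} (lam : Fin n → ℕ)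
  (rdAll : ∀ q : ℕ, Equiv.Perm (Fin q) → List ℕ)

/-- The permutation module `M(i,λ)` over `R_{kδ}`. -/
abbrev MPerm : Type :=
  QuotBy O (segTup e k i) (permGens O (segTup e k i) (segTup e k i) (blockPsiSet e k lam))

/-- The cyclic generator `m(i,λ)` of `M(i,λ)`. -/
abbrev mPerm : MPerm O e k i lam :=
  genQ O (segTup e k i) (permGens O (segTup e k i) (segTup e k i) (blockPsiSet e k lam))

/-- The block intertwiner `σ_r = ψ_{w_r} e(i,λ)` (0-indexed `rb`). -/
def sigmaB (rb : ℕ) : KLR O e (k * e) (segTup e k i) :=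
  psiWord O (segTup e k i) (rdAll (k * e) (wBrickP (k * e) 0 e rb)) * eK O (segTup e k i) (segTup e k i)

/-- The block intertwiner `τ_r = σ_r + e(i,λ)`. -/
def tauB (rb : ℕ) : KLR O e (k * e) (segTup e k i) :=
  sigmaB O e k i rdAll rb + eK O (segTup e k i) (segTup e k i)

/-- `τ_u` for `u ∈ S_k`, via the preferred reduced decomposition of `u`. -/
def tauBU (u : Equiv.Perm (Fin k)) : KLR O e (k * e) (segTup e k i) :=
  ((rdAll k u).map (tauB O e k i rdAll)).prod

/-- The block permutation subspace `T(i,λ) ⊆ M(i,λ)`. -/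
def TBlock : Submodule O (MPerm O e k i lam) :=
  Submodule.span O {v | ∃ rs : List ℕ, (∀ rb ∈ rs, rb + 1 < k) ∧
    v = ((rs.map (sigmaB O e k i rdAll)).prod) • mPerm O e k i lam}

/-- The parabolic subgroup `S_λ = S_{λ_1} × ⋯ × S_{λ_n}` of `S_k`. -/
def SlamSub : Subgroup (Equiv.Perm (Fin k)) :=
  Subgroup.closure {w | ∃ r, r + 1 < k ∧ (r + 1) ∉ cutSet 1 lam ∧ w = stp k r}

/-- The minimal length left coset representatives `D_λ` of `S_λ` in `S_k`. -/
def DlamSet : Set (Equiv.Perm (Fin k)) := {u | IsMinCosetRep k (SlamSub k lam) u}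

end Block

/-! ## Auxiliary: rank matrices and the tableau criterion for the Bruhat order -/

lemma stp_val {d r : ℕ} (hr : r + 1 < d) (a : Fin d) :
    (stp d r a).val = if a.val = r then r + 1 else if a.val = r + 1 then r else a.val := by
  unfold stp
  rw [dif_pos hr, Equiv.swap_apply_def]
  split_ifs <;> simp_all [Fin.ext_iff]

lemma stp_mul_self {d r : ℕ} (w : Equiv.Perm (Fin d)) : stp d r * (stp d r * w) = w := by
  unfold stp
  split_ifs <;> simp

/-- Rank matrix of a permutation. -/
def rkm {d : ℕ} (w : Equiv.Perm (Fin d)) (i j : ℕ) : ℕ :=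
  (Finset.univ.filter (fun a : Fin d => a.val < i ∧ (w a).val < j)).card

lemma rkm_succ {d : ℕ} (w : Equiv.Perm (Fin d)) (i j : ℕ) (hj : j < d) :
    rkm w i (j + 1) = rkm w i j + if (w.symm ⟨j, hj⟩).val < i then 1 else 0 := by
  unfold rkm
  split_ifs with h
  · rw [← Finset.card_insert_of_notMem (a := w.symm ⟨j, hj⟩) (by simp)]
    apply congrArg Finset.card
    ext a
    simp only [Finset.mem_filter, Finset.mem_univ, true_and, Finset.mem_insert]
    rw [Equiv.eq_symm_apply, Fin.ext_iff]
    constructor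
    · rintro ⟨h1, h2⟩
      by_cases h3 : (w a).val = j
      · left; exact h3
      · right; omega
    · rintro (h1 | h1)
      · have : a = w.symm ⟨j, hj⟩ := by rw [Equiv.eq_symm_apply, Fin.ext_iff]; exact h1
        subst this
        exact ⟨h, by simp⟩
      · omega
  · refine (congrArg Finset.card ?_).trans (Nat.add_zero _).symm
    ext a
    simp only [Finset.mem_filter, Finset.mem_univ, true_and]
    constructor
    · rintro ⟨h1, h2⟩
      refine ⟨h1, ?_⟩
      by_contra h3
      have : a = w.symm ⟨j, hj⟩ := by
        rw [Equiv.eq_symm_apply, Fin.ext_iff]; simp only; omega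
      subst this
      exact h h1
    · omega

lemma rkm_stp_ne {d r : ℕ} (hr : r + 1 < d) (w : Equiv.Perm (Fin d)) (i j : ℕ) (hj : j ≠ r + 1) :
    rkm (stp d r * w) i j = rkm w i j := by
  unfold rkm
  apply congrArg Finset.card
  ext a
  simp only [Finset.mem_filter, Finset.mem_univ, true_and, Equiv.Perm.mul_apply, stp_val hr]
  split_ifs <;> omega

/-- `r` is a left ascent of `w`. -/
def LAsc {d r : ℕ} (hr : r + 1 < d) (w : Equiv.Perm (Fin d)) : Prop :=
  (w.symm ⟨r, Nat.lt_of_succ_lt hr⟩).val < (w.symm ⟨r + 1, hr⟩).val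

lemma symm_stp_mul_l {d r : ℕ} (hr : r + 1 < d) (w : Equiv.Perm (Fin d)) :
    (stp d r * w).symm ⟨r, Nat.lt_of_succ_lt hr⟩ = w.symm ⟨r + 1, hr⟩ := by
  rw [Equiv.symm_apply_eq]
  simp [Fin.ext_iff, stp_val hr]

lemma symm_stp_mul_r {d r : ℕ} (hr : r + 1 < d) (w : Equiv.Perm (Fin d)) :
    (stp d r * w).symm ⟨r + 1, hr⟩ = w.symm ⟨r, Nat.lt_of_succ_lt hr⟩ := by
  rw [Equiv.symm_apply_eq]
  simp [Fin.ext_iff, stp_val hr]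

lemma not_LAsc {d r : ℕ} (hr : r + 1 < d) (w : Equiv.Perm (Fin d)) (h : ¬ LAsc hr w) :
    LAsc hr (stp d r * w) := by
  unfold LAsc at *
  rw [symm_stp_mul_l hr, symm_stp_mul_r hr]
  have : (w.symm ⟨r, Nat.lt_of_succ_lt hr⟩).val ≠ (w.symm ⟨r + 1, hr⟩).val := by
    intro h2
    have := w.symm.injective (Fin.ext h2)
    simp [Fin.ext_iff] at this
  omega

/-- pointwise comparison of rank matrices -/
def RkGe {d : ℕ} (u w : Equiv.Perm (Fin d)) : Prop := ∀ i j, rkm w i j ≤ rkm u i j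

lemma rk_bounds {d r : ℕ} (hr : r + 1 < d) (w : Equiv.Perm (Fin d)) (i : ℕ) :
    rkm w i r ≤ rkm w i (r + 1) ∧ rkm w i (r + 1) ≤ rkm w i r + 1 ∧
    rkm w i (r + 1) ≤ rkm w i (r + 2) ∧ rkm w i (r + 2) ≤ rkm w i (r + 1) + 1 := by
  have h1 := rkm_succ w i r (by omega)
  have h2 : rkm w i (r + 2) = _ := rkm_succ w i (r + 1) hr
  split_ifs at h1 h2 <;> omega

lemma rk_asc {d r : ℕ} (hr : r + 1 < d) (w : Equiv.Perm (Fin d)) (h : LAsc hr w) (i : ℕ) :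
    rkm w i (r + 1) = min (rkm w i r + 1) (rkm w i (r + 2)) := by
  have h1 := rkm_succ w i r (by omega)
  have h2 : rkm w i (r + 2) = _ := rkm_succ w i (r + 1) hr
  unfold LAsc at h
  split_ifs at h1 h2 <;> omega

lemma rk_desc {d r : ℕ} (hr : r + 1 < d) (w : Equiv.Perm (Fin d)) (h : LAsc hr w) (i : ℕ) :
    rkm (stp d r * w) i (r + 1) = max (rkm w i r) (rkm w i (r + 2) - 1) := by
  have h1 := rkm_succ w i r (by omega)
  have h2 : rkm w i (r + 2) = _ := rkm_succ w i (r + 1) hr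
  have h3 := rkm_succ (stp d r * w) i r (by omega)
  rw [symm_stp_mul_l hr, rkm_stp_ne hr w i r (by omega)] at h3
  unfold LAsc at h
  split_ifs at h1 h2 h3 <;> omega

lemma RkGe.up {d r : ℕ} (hr : r + 1 < d) {u w : Equiv.Perm (Fin d)} (h : LAsc hr w)
    (huw : RkGe u w) : RkGe u (stp d r * w) ∧ RkGe (stp d r * u) (stp d r * w) := by
  constructor <;> intro i j <;> by_cases hj : j = r + 1
  · subst hj
    have h1 := rk_desc hr w h i
    have h2 := rk_bounds hr w i
    have h3 := huw i (r + 1)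
    omega
  · rw [rkm_stp_ne hr _ _ _ hj]; exact huw i j
  · subst hj
    have h1 := rk_desc hr w h i
    have h2 := rk_bounds hr (stp d r * u) i
    rw [rkm_stp_ne hr u i r (by omega), rkm_stp_ne hr u i (r + 2) (by omega)] at h2
    have h3 := huw i r
    have h4 := huw i (r + 2)
    omega
  · rw [rkm_stp_ne hr _ _ _ hj, rkm_stp_ne hr _ _ _ hj]; exact huw i j

/-- If `u` has an ascent at `r`, lowering `w` along `r` preserves comparison; formulated
uniformly for `u` replaced by any `v ∈ {u, s u}`. -/
lemma RkGe.down {d r : ℕ} (hr : r + 1 < d) {u v w : Equiv.Perm (Fin d)} (hv : LAsc hr v)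
    (huv : v = u ∨ v = stp d r * u)
    (huw : RkGe u w) : RkGe v (stp d r * w) := by
  have key : ∀ i j, j ≠ r + 1 → rkm v i j = rkm u i j := by
    intro i j hj
    rcases huv with rfl | rfl
    · rfl
    · exact rkm_stp_ne hr _ _ _ hj
  intro i j
  by_cases hj : j = r + 1
  · subst hj
    have h1 := rk_asc hr v hv i
    rw [key i r (by omega), key i (r + 2) (by omega)] at h1
    have h2 := rk_bounds hr (stp d r * w) i
    rw [rkm_stp_ne hr w i r (by omega), rkm_stp_ne hr w i (r + 2) (by omega)] at h2
    have h3 := huw i r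
    have h4 := huw i (r + 2)
    omega
  · rw [rkm_stp_ne hr _ _ _ hj, key i j hj]; exact huw i j

/-- Inversion set. -/
def invs {d : ℕ} (w : Equiv.Perm (Fin d)) : Finset (Fin d × Fin d) :=
  Finset.univ.filter (fun p => p.1 < p.2 ∧ w p.2 < w p.1)

lemma invs_asc {d r : ℕ} (hr : r + 1 < d) (w : Equiv.Perm (Fin d)) (h : LAsc hr w) :
    (invs (stp d r * w)).card = (invs w).card + 1 := by
  set p := w.symm ⟨r, Nat.lt_of_succ_lt hr⟩ with hp
  set q := w.symm ⟨r + 1, hr⟩ with hq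
  have hpq : p < q := h
  have hwp : (w p).val = r := by simp [hp]
  have hwq : (w q).val = r + 1 := by simp [hq]
  rw [← Finset.card_insert_of_notMem (a := (p, q))]
  · congr 1
    ext ⟨a, b⟩
    simp only [invs, Finset.mem_filter, Finset.mem_univ, true_and, Finset.mem_insert,
      Prod.mk.injEq, Equiv.Perm.mul_apply, Fin.lt_def, stp_val hr]
    have ea : (w a).val = r ↔ a = p := by
      rw [hp, Equiv.eq_symm_apply, Fin.ext_iff]
    have ea' : (w a).val = r + 1 ↔ a = q := by
      rw [hq, Equiv.eq_symm_apply, Fin.ext_iff]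
    have eb : (w b).val = r ↔ b = p := by
      rw [hp, Equiv.eq_symm_apply, Fin.ext_iff]
    have eb' : (w b).val = r + 1 ↔ b = q := by
      rw [hq, Equiv.eq_symm_apply, Fin.ext_iff]
    rw [Fin.lt_def] at hpq
    rw [Fin.ext_iff] at ea ea' eb eb'
    rw [Fin.ext_iff, Fin.ext_iff]
    split_ifs <;> omega
  · simp only [invs, Finset.mem_filter, Finset.mem_univ, true_and, Fin.lt_def]
    omega

lemma invs_desc {d r : ℕ} (hr : r + 1 < d) (w : Equiv.Perm (Fin d)) (h : ¬ LAsc hr w) :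
    (invs (stp d r * w)).card + 1 = (invs w).card := by
  have := invs_asc hr _ (not_LAsc hr w h)
  rw [stp_mul_self] at this
  exact this.symm

lemma wordProd_cons (d r : ℕ) (lw : List ℕ) :
    wordProd d (r :: lw) = stp d r * wordProd d lw := by
  simp [wordProd]

lemma invs_le_word {d : ℕ} (lw : List ℕ) (h : IsWord d lw) :
    (invs (wordProd d lw)).card ≤ lw.length := by
  induction lw with
  | nil =>
    simp [wordProd, invs]
    intro a b; omega
  | cons r lw ih =>
    have hr : r + 1 < d := h r (by simp)
    have ih' := ih (fun x hx => h x (by simp [hx]))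
    rw [wordProd_cons, List.length_cons]
    by_cases ha : LAsc hr (wordProd d lw)
    · rw [invs_asc hr _ ha]; omega
    · have := invs_desc hr _ ha; omega

lemma eq_one_of_le {d : ℕ} (u : Equiv.Perm (Fin d)) (h : ∀ a, u a ≤ a) : u = 1 := by
  refine Equiv.ext fun a => ?_
  rw [Equiv.Perm.one_apply]
  induction a using WellFoundedLT.induction with
  | _ a ih =>
    rcases (h a).lt_or_eq with h1 | h1
    · have := u.injective (ih _ h1)
      rw [this] at h1
      exact absurd h1 (lt_irrefl _)
    · exact h1

lemma eq_one_of_asc {d : ℕ} (w : Equiv.Perm (Fin d)) (h : ∀ r (hr : r + 1 < d), LAsc hr w) :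
    w = 1 := by
  have key : ∀ n (hn : n < d), n ≤ (w.symm ⟨n, hn⟩).val := by
    intro n
    induction n with
    | zero => intro hn; omega
    | succ n ih =>
      intro hn
      have h1 := ih (by omega)
      have h2 := h n hn
      unfold LAsc at h2
      omega
  apply eq_one_of_le
  intro a
  have h1 := key (w a).val (w a).isLt
  rw [Fin.eta, Equiv.symm_apply_apply] at h1
  exact h1

lemma exists_word {d : ℕ} (w : Equiv.Perm (Fin d)) :
    ∃ lw, IsWord d lw ∧ wordProd d lw = w ∧ lw.length = (invs w).card := by
  induction hn : (invs w).card generalizing w with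
  | zero =>
    refine ⟨[], by simp [IsWord], ?_, rfl⟩
    have : w = 1 := by
      apply eq_one_of_asc
      intro r hr
      by_contra hc
      have := invs_desc hr w hc
      omega
    simp [wordProd, this]
  | succ n ih =>
    by_cases hall : ∀ r (hr : r + 1 < d), LAsc hr w
    · have := eq_one_of_asc w hall
      subst this
      have h1 := invs_le_word (d := d) [] (by simp [IsWord])
      simp only [wordProd, List.map_nil, List.prod_nil, List.length_nil] at h1
      omega
    · push Not at hall
      obtain ⟨r, hr, hd⟩ := hall
      have h1 := invs_desc hr w hd
      obtain ⟨lw, h2, h3, h4⟩ := ih (stp d r * w) (by omega)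
      refine ⟨r :: lw, ?_, ?_, by simp [h4]⟩
      · intro x hx
        rcases List.mem_cons.1 hx with rfl | hx
        · exact hr
        · exact h2 x hx
      · rw [wordProd_cons, h3, stp_mul_self]

lemma len_eq {d : ℕ} (w : Equiv.Perm (Fin d)) : len d w = (invs w).card := by
  unfold len
  apply le_antisymm
  · obtain ⟨lw, h1, h2, h3⟩ := exists_word w
    exact Nat.sInf_le ⟨lw, h1, h3, h2⟩
  · apply le_csInf
    · obtain ⟨lw, h1, h2, h3⟩ := exists_word w
      exact ⟨_, lw, h1, h3, h2⟩
    · rintro n ⟨lw, h1, rfl, rfl⟩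
      exact invs_le_word lw h1

lemma rkGe_of_sublist {d : ℕ} (lw : List ℕ) (h : IsWord d lw)
    (hl : lw.length = (invs (wordProd d lw)).card) (lu : List ℕ) (hs : lu.Sublist lw) :
    RkGe (wordProd d lu) (wordProd d lw) := by
  induction lw generalizing lu with
  | nil =>
    rw [List.sublist_nil] at hs
    subst hs
    intro i j; exact le_rfl
  | cons r lw ih =>
    have hr : r + 1 < d := h r (by simp)
    have hw : IsWord d lw := fun x hx => h x (by simp [hx])
    have hle := invs_le_word lw hw
    rw [wordProd_cons, List.length_cons] at hl
    by_cases ha : LAsc hr (wordProd d lw)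
    · rw [invs_asc hr _ ha] at hl
      have ih' := ih hw (by omega)
      rw [wordProd_cons]
      rcases List.sublist_cons_iff.1 hs with h1 | ⟨l', rfl, h1⟩
      · exact ((ih' _ h1).up hr ha).1
      · rw [wordProd_cons]
        exact ((ih' _ h1).up hr ha).2
    · have := invs_desc hr _ ha; omega

lemma eq_one_of_rkGe {d : ℕ} (u : Equiv.Perm (Fin d)) (h : RkGe u 1) : u = 1 := by
  apply eq_one_of_le
  intro a
  have h1 := h (a.val + 1) (a.val + 1)
  unfold rkm at h1
  simp only [Equiv.Perm.one_apply, and_self] at h1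
  have h2 : (Finset.univ.filter (fun b : Fin d => b.val < a.val + 1 ∧ (u b).val < a.val + 1)) =
      Finset.univ.filter (fun b : Fin d => b.val < a.val + 1) := by
    apply Finset.eq_of_subset_of_card_le _ h1
    intro b
    simp only [Finset.mem_filter, Finset.mem_univ, true_and]
    exact fun hb => hb.1
  have h3 : a ∈ Finset.univ.filter (fun b : Fin d => b.val < a.val + 1) := by simp
  rw [← h2] at h3
  simp only [Finset.mem_filter, Finset.mem_univ, true_and] at h3
  rw [Fin.le_def]
  omega

lemma sublist_of_rkGe {d : ℕ} (u w : Equiv.Perm (Fin d)) (h : RkGe u w) :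
    ∃ lw, (IsWord d lw ∧ wordProd d lw = w ∧ lw.length = (invs w).card) ∧
      ∃ lu, lu.Sublist lw ∧ wordProd d lu = u := by
  induction hn : (invs w).card using Nat.strong_induction_on generalizing u w with
  | _ n ih =>
    by_cases hall : ∀ r (hr : r + 1 < d), LAsc hr w
    · obtain ⟨lw, h1, h2, h3⟩ := exists_word w
      have hw := eq_one_of_asc w hall
      refine ⟨lw, ⟨h1, h2, h3.trans hn⟩, [], by simp, ?_⟩
      rw [hw] at h
      rw [eq_one_of_rkGe u h]
      simp [wordProd]
    · push Not at hall
      obtain ⟨r, hr, hd⟩ := hall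
      have h1 := invs_desc hr w hd
      have fin : ∀ v, LAsc hr v → (v = u ∨ v = stp d r * u) →
          ∃ lw, (IsWord d lw ∧ wordProd d lw = w ∧ lw.length = n) ∧
          ∃ lu, lu.Sublist lw ∧ wordProd d lu = u := by
        intro v hv hvu
        obtain ⟨lw, ⟨h2, h3, h4⟩, lu, h5, h6⟩ :=
          ih (invs (stp d r * w)).card (by omega) v _ (h.down hr hv hvu) rfl
        refine ⟨r :: lw, ⟨?_, ?_, by simp [h4]; omega⟩, ?_⟩
        · intro x hx
          rcases List.mem_cons.1 hx with rfl | hx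
          · exact hr
          · exact h2 x hx
        · rw [wordProd_cons, h3, stp_mul_self]
        · rcases hvu with e | e
          · exact ⟨lu, h5.cons r, h6.trans e⟩
          · exact ⟨r :: lu, h5.cons_cons r, by rw [wordProd_cons, h6, e, stp_mul_self]⟩
      by_cases hu : LAsc hr u
      · exact fin u hu (Or.inl rfl)
      · exact fin _ (not_LAsc hr u hu) (Or.inr rfl)

theorem bruhat_iff {d : ℕ} (u w : Equiv.Perm (Fin d)) : Bruhat d u w ↔ RkGe u w := by
  constructor
  · rintro ⟨lw, ⟨h1, h2, h3⟩, lu, h4, rfl⟩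
    rw [len_eq] at h3
    subst h2
    exact rkGe_of_sublist lw h1 h3 lu h4
  · intro h
    obtain ⟨lw, ⟨h1, h2, h3⟩, lu, h4, h5⟩ := sublist_of_rkGe u w h
    exact ⟨lw, ⟨h1, h2, by rw [len_eq]; exact h3⟩, lu, h4, h5⟩

/-! ## Auxiliary: tableaux -/

lemma exists_threshold {d : ℕ} (P : Fin d → Prop) (hP : ∀ a b, a ≤ b → P b → P a) :
    ∃ i : ℕ, ∀ a : Fin d, P a ↔ a.val < i := by
  classical
  by_cases h : ∃ n, ∃ hn : n < d, ¬ P ⟨n, hn⟩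
  · refine ⟨Nat.find h, fun a => ?_⟩
    obtain ⟨hn, hnP⟩ := Nat.find_spec h
    constructor
    · intro ha
      by_contra hc
      exact hnP (hP _ a (by rw [Fin.le_def]; simp only; omega) ha)
    · intro ha
      have := Nat.find_min h ha
      push Not at this
      exact this a.isLt
  · push Not at h
    exact ⟨d, fun a => ⟨fun _ => a.isLt, fun _ => h a.val a.isLt⟩⟩

/-- Abstract exchange of dominance: `X` finite, `A, B, S, T` bijections to `Fin d`. -/
lemma rkGe_reverse {X : Type*} {d : ℕ} (A B S T : X ≃ Fin d)
    (hex : ∀ j k : ℕ, ∃ i : ℕ,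
      (∀ x, (T x).val < k → (A x).val < i ∨ (B x).val < j) ∧
      (∀ x, (A x).val < i → (B x).val < j → (T x).val < k))
    (h : RkGe (A.symm.trans S) (A.symm.trans T)) :
    RkGe (B.symm.trans T) (B.symm.trans S) := by
  classical
  let _ : Fintype X := Fintype.ofEquiv _ A.symm
  have hrk : ∀ (C U : X ≃ Fin d) (i j : ℕ), rkm (C.symm.trans U) i j =
      (Finset.univ.filter (fun x : X => (C x).val < i ∧ (U x).val < j)).card := by
    intro C U i j
    unfold rkm
    apply Finset.card_equiv C.symm
    intro a
    rw [Finset.mem_filter, Finset.mem_filter]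
    simp only [Finset.mem_univ, true_and, Equiv.trans_apply, Equiv.apply_symm_apply]
  intro j k
  obtain ⟨i, h1, h2⟩ := hex j k
  have h3 := h i k
  simp only [hrk] at h3 ⊢
  have hcard : ∀ U : X ≃ Fin d, (Finset.univ.filter (fun x : X => (U x).val < k)).card =
      (Finset.univ.filter (fun a : Fin d => a.val < k)).card := by
    intro U
    apply Finset.card_equiv U
    intro a
    simp
  have hie : ∀ U : X ≃ Fin d,
      (Finset.univ.filter (fun x : X => (A x).val < i ∧ (U x).val < k)).card +
      (Finset.univ.filter (fun x : X => (B x).val < j ∧ (U x).val < k)).card =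
      (Finset.univ.filter (fun x : X => ((A x).val < i ∨ (B x).val < j) ∧ (U x).val < k)).card +
      (Finset.univ.filter
        (fun x : X => ((A x).val < i ∧ (B x).val < j) ∧ (U x).val < k)).card := by
    intro U
    rw [← Finset.card_union_add_card_inter]
    congr 2 <;> ext x <;> simp <;> tauto
  have hT := hie T
  have hS := hie S
  have e1 : (Finset.univ.filter
      (fun x : X => ((A x).val < i ∨ (B x).val < j) ∧ (T x).val < k)).card =
      (Finset.univ.filter (fun x : X => (T x).val < k)).card := by
    congr 1; ext x; simp; exact h1 x
  have e2 : (Finset.univ.filter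
      (fun x : X => ((A x).val < i ∨ (B x).val < j) ∧ (S x).val < k)).card ≤
      (Finset.univ.filter (fun x : X => (S x).val < k)).card := by
    apply Finset.card_le_card
    intro x; simp
  have e3 : (Finset.univ.filter
      (fun x : X => ((A x).val < i ∧ (B x).val < j) ∧ (S x).val < k)).card ≤
      (Finset.univ.filter
        (fun x : X => ((A x).val < i ∧ (B x).val < j) ∧ (T x).val < k)).card := by
    apply Finset.card_le_card
    intro x; simp
    intro a b _
    exact ⟨⟨a, b⟩, h2 x a b⟩
  rw [hcard] at e1 e2
  omega

lemma colLt_trichotomy {l : ℕ} (x y : Node l) : colLt x y ∨ x = y ∨ colLt y x := by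
  obtain ⟨a, b, m⟩ := x
  obtain ⟨a', b', m'⟩ := y
  simp only [colLt, Prod.mk.injEq, Fin.lt_def, Fin.ext_iff]
  omega

lemma rowLt_trichotomy {l : ℕ} (x y : Node l) : rowLt x y ∨ x = y ∨ rowLt y x := by
  obtain ⟨a, b, m⟩ := x
  obtain ⟨a', b', m'⟩ := y
  simp only [rowLt, Prod.mk.injEq, Fin.lt_def, Fin.ext_iff]
  omega

lemma MPar.col_le_iff {l d : ℕ} (μ : MPar l d) {Tc : μ.Tab} (h : μ.IsColReading Tc)
    (x y : μ.NodeIn) : Tc x < Tc y ↔ colLt x.1 y.1 := by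
  refine ⟨fun hlt => ?_, h x y⟩
  rcases colLt_trichotomy x.1 y.1 with h1 | h1 | h1
  · exact h1
  · rw [Subtype.ext h1] at hlt; exact absurd hlt (lt_irrefl _)
  · exact absurd hlt (lt_asymm (h y x h1))

lemma MPar.row_le_iff {l d : ℕ} (μ : MPar l d) {Tr : μ.Tab} (h : μ.IsRowReading Tr)
    (x y : μ.NodeIn) : Tr x < Tr y ↔ rowLt x.1 y.1 := by
  refine ⟨fun hlt => ?_, h x y⟩
  rcases rowLt_trichotomy x.1 y.1 with h1 | h1 | h1
  · exact h1
  · rw [Subtype.ext h1] at hlt; exact absurd hlt (lt_irrefl _)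
  · exact absurd hlt (lt_asymm (h y x h1))

/-- The standard tableau property: entries weakly increase to the south-east. -/
lemma MPar.std_mono {l d : ℕ} (μ : MPar l d) {T : μ.Tab} (hT : μ.IsStandard T)
    (x y : μ.NodeIn) (hm : x.1.2.2 = y.1.2.2) (ha : x.1.1 ≤ y.1.1) (hb : x.1.2.1 ≤ y.1.2.1) :
    T x ≤ T y := by
  obtain ⟨⟨a, b, m⟩, hx⟩ := x
  obtain ⟨⟨a', b', m'⟩, hy⟩ := y
  simp only at hm ha hb
  subst hm
  have hz : μ.mem (a, b', m) := by
    unfold MPar.mem at *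
    exact lt_of_lt_of_le hy (μ.anti m ha)
  have h1 : T ⟨(a, b, m), hx⟩ ≤ T ⟨(a, b', m), hz⟩ := by
    rcases hb.lt_or_eq with h | h
    · exact (hT.1 ⟨(a, b, m), hx⟩ ⟨(a, b', m), hz⟩ rfl rfl h).le
    · subst h; exact le_rfl
  have h2 : T ⟨(a, b', m), hz⟩ ≤ T ⟨(a', b', m), hy⟩ := by
    rcases ha.lt_or_eq with h | h
    · exact (hT.2 ⟨(a, b', m), hz⟩ ⟨(a', b', m), hy⟩ rfl rfl h).le
    · subst h; exact le_rfl
  exact h1.trans h2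

lemma MPar.exists_node_lt {l d : ℕ} (μ : MPar l d) (B : μ.Tab) (j : ℕ) :
    (∀ x, ¬ (B x).val < j) ∨ ∃ z, ∀ x, (B x).val < j ↔ ¬ B z < B x := by
  by_cases h : j = 0 ∨ d = 0
  · left
    intro x
    have := (B x).isLt
    omega
  · right
    refine ⟨B.symm ⟨min j d - 1, by omega⟩, fun x => ?_⟩
    have := (B x).isLt
    rw [Equiv.apply_symm_apply, Fin.lt_def]
    simp only
    omega

lemma MPar.hex_row {l d : ℕ} (μ : MPar l d) {Tr Tc T : μ.Tab} (hTr : μ.IsRowReading Tr)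
    (hTc : μ.IsColReading Tc) (hT : μ.IsStandard T) (j k : ℕ) : ∃ i : ℕ,
      (∀ x, (T x).val < k → (Tr x).val < i ∨ (Tc x).val < j) ∧
      (∀ x, (Tr x).val < i → (Tc x).val < j → (T x).val < k) := by
  rcases μ.exists_node_lt Tc j with h | ⟨z, hz⟩
  · exact ⟨d, fun x _ => Or.inl (Tr x).isLt, fun x _ hx => absurd hx (h x)⟩
  · obtain ⟨i, hi⟩ := exists_threshold (fun a : Fin d =>
      (Tr.symm a).1.2.2 < z.1.2.2 ∨ ((Tr.symm a).1.2.2 = z.1.2.2 ∧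
        ∃ y : μ.NodeIn, y.1.2.2 = z.1.2.2 ∧ y.1.2.1 = z.1.2.1 ∧ (T y).val < k ∧
          (Tr.symm a).1.1 ≤ y.1.1)) (by
        intro a b hab hb
        rcases hab.lt_or_eq with hab | rfl
        · have h1 := (μ.row_le_iff hTr (Tr.symm a) (Tr.symm b)).1 (by simpa using hab)
          simp only [rowLt, Fin.lt_def, Fin.ext_iff] at h1 hb ⊢
          rcases hb with hb | ⟨hb, y, h2, h3, h4, h5⟩
          · left; omega
          · rcases h1 with h1 | ⟨h1, h6⟩
            · left; omega
            · right; exact ⟨by omega, y, h2, h3, h4, by omega⟩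
        · exact hb)
    refine ⟨i, fun x hx => ?_, fun x h1 h2 => ?_⟩
    · rw [or_iff_not_imp_right, ← hi, hz, not_not, μ.col_le_iff hTc, Equiv.symm_apply_apply]
      intro hc
      rcases hc with hc | ⟨hm, hc⟩
      · left; exact hc
      · right
        refine ⟨hm.symm, ?_⟩
        obtain ⟨⟨a, b, m⟩, hxm⟩ := x
        simp only at hm hc ⊢
        have hy : μ.mem (a, z.1.2.1, m) := by
          have hxm' : b < μ.part m a := hxm
          change z.1.2.1 < μ.part m a
          omega
        refine ⟨⟨(a, z.1.2.1, m), hy⟩, hm.symm, rfl, ?_, le_rfl⟩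
        have := μ.std_mono hT ⟨(a, z.1.2.1, m), hy⟩ ⟨(a, b, m), hxm⟩ rfl le_rfl
          (by simp only; omega)
        rw [Fin.le_def] at this
        omega
    · rw [← hi, Equiv.symm_apply_apply] at h1
      rw [hz, μ.col_le_iff hTc] at h2
      simp only [colLt, Fin.lt_def, Fin.ext_iff] at h1 h2
      rcases h1 with h1 | ⟨h1, y, h3, h4, h5, h6⟩
      · omega
      · have := μ.std_mono hT x y (by rw [Fin.ext_iff]; omega) h6 (by omega)
        rw [Fin.le_def] at this
        omega

lemma MPar.hex_col {l d : ℕ} (μ : MPar l d) {Tr Tc T : μ.Tab} (hTr : μ.IsRowReading Tr)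
    (hTc : μ.IsColReading Tc) (hT : μ.IsStandard T) (j k : ℕ) : ∃ i : ℕ,
      (∀ x, (T x).val < k → (Tc x).val < i ∨ (Tr x).val < j) ∧
      (∀ x, (Tc x).val < i → (Tr x).val < j → (T x).val < k) := by
  rcases μ.exists_node_lt Tr j with h | ⟨z, hz⟩
  · exact ⟨d, fun x _ => Or.inl (Tc x).isLt, fun x _ hx => absurd hx (h x)⟩
  · obtain ⟨i, hi⟩ := exists_threshold (fun a : Fin d =>
      z.1.2.2 < (Tc.symm a).1.2.2 ∨ ((Tc.symm a).1.2.2 = z.1.2.2 ∧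
        ∃ y : μ.NodeIn, y.1.2.2 = z.1.2.2 ∧ y.1.1 = z.1.1 ∧ (T y).val < k ∧
          (Tc.symm a).1.2.1 ≤ y.1.2.1)) (by
        intro a b hab hb
        rcases hab.lt_or_eq with hab | rfl
        · have h1 := (μ.col_le_iff hTc (Tc.symm a) (Tc.symm b)).1 (by simpa using hab)
          simp only [colLt, Fin.lt_def, Fin.ext_iff] at h1 hb ⊢
          rcases hb with hb | ⟨hb, y, h2, h3, h4, h5⟩
          · left; omega
          · rcases h1 with h1 | ⟨h1, h6⟩
            · left; omega
            · right; exact ⟨by omega, y, h2, h3, h4, by omega⟩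
        · exact hb)
    refine ⟨i, fun x hx => ?_, fun x h1 h2 => ?_⟩
    · rw [or_iff_not_imp_right, ← hi, hz, not_not, μ.row_le_iff hTr, Equiv.symm_apply_apply]
      intro hc
      rcases hc with hc | ⟨hm, hc⟩
      · left; exact hc
      · right
        refine ⟨hm.symm, ?_⟩
        obtain ⟨⟨a, b, m⟩, hxm⟩ := x
        simp only at hm hc ⊢
        have hza : z.1.1 ≤ a := by omega
        have hy : μ.mem (z.1.1, b, m) := by
          unfold MPar.mem at *
          exact lt_of_lt_of_le hxm (μ.anti m hza)
        refine ⟨⟨(z.1.1, b, m), hy⟩, hm.symm, rfl, ?_, le_rfl⟩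
        have := μ.std_mono hT ⟨(z.1.1, b, m), hy⟩ ⟨(a, b, m), hxm⟩ rfl hza le_rfl
        rw [Fin.le_def] at this
        omega
    · rw [← hi, Equiv.symm_apply_apply] at h1
      rw [hz, μ.row_le_iff hTr] at h2
      simp only [rowLt, Fin.lt_def, Fin.ext_iff] at h1 h2
      rcases h1 with h1 | ⟨h1, y, h3, h4, h5, h6⟩
      · omega
      · have := μ.std_mono hT x y (by rw [Fin.ext_iff]; omega) (by omega) h6
        rw [Fin.le_def] at this
        omega

/-- Row-reading tableaux are unique. -/
lemma MPar.rowReading_unique {l d : ℕ} (μ : MPar l d) {A B : μ.Tab} (hA : μ.IsRowReading A)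
    (hB : μ.IsRowReading B) : A = B := by
  have h1 : (A.symm.trans B : Equiv.Perm (Fin d)) = 1 := by
    apply eq_one_of_asc
    intro r hr
    unfold LAsc
    change A (B.symm _) < A (B.symm _)
    rw [μ.row_le_iff hA, ← μ.row_le_iff hB]
    simp
  ext x
  have := congrArg (fun w : Equiv.Perm (Fin d) => (w (A x)).val) h1
  simp at this
  exact this.symm

lemma conj_colReading {l d : ℕ} {μ ν : MPar l d} (hconj : IsConjugate μ ν)
    {Tνc : ν.Tab} (h : ν.IsColReading Tνc) :
    μ.IsRowReading ((Equiv.subtypeEquiv (nodeConjEquiv l) (fun x => hconj x)).trans Tνc) := by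
  intro x y hxy
  apply h
  change colLt (nodeConj x.1) (nodeConj y.1)
  simp only [rowLt, colLt, nodeConj, Fin.rev_lt_rev, Fin.rev_inj] at *
  exact hxy

/-! ## STATEMENT 1: `w_{T'} = w^T`, and `T ⊴ S ↔ w^T ≥ w^S`. -/

theorem conjTab_w_eq_and_bruhat {l d : ℕ} (μ ν : MPar l d) (hconj : IsConjugate μ ν)
    (Tr : μ.Tab) (hTr : μ.IsRowReading Tr) (Tc : μ.Tab) (hTc : μ.IsColReading Tc)
    (Tνc : ν.Tab) (hTνc : ν.IsColReading Tνc)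
    (S T : μ.Tab) (hS : μ.IsStandard S) (hT : μ.IsStandard T) :
    ν.wTab (conjTab hconj T) Tνc = μ.wTab T Tr ∧
    (Bruhat d (μ.wTab T Tc) (μ.wTab S Tc) ↔ Bruhat d (μ.wTab S Tr) (μ.wTab T Tr)) := by
  constructor
  · have h1 := μ.rowReading_unique hTr (conj_colReading hconj hTνc)
    subst h1
    rfl
  · rw [bruhat_iff, bruhat_iff]
    exact ⟨rkGe_reverse Tc Tr T S (μ.hex_col hTr hTc hS),
      rkGe_reverse Tr Tc S T (μ.hex_row hTr hTc hT)⟩
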